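/- arXiv:math/9307217 — 2 statements merged into one kernel-verified Lean document; each statement's English description precedes it below -/
import Mathlib

section
/- Let α, c be complex numbers with c+α ≠ 0 such that neither 1+α nor 1−α is a nonpositive integer. Then for every complex x, (c/(c+α)) · ₁F₁(1−c; 1+α; x) · ₁F₁(−c−α; 1−α; x) − ₁F₁(−c; 1+α; x) · ₁F₁(1−c−α; 1−α; x) = −(α/(c+α)) e^x. -/
/-- Pochhammer symbol `(a)_k` for complex `a`. -/
noncomputable def pochC (a : ℂ) (k : ℕ) : ℂ := (ascPochhammer ℂ k).eval a

/-- Confluent hypergeometric series `₁F₁(a; b; x)`. -/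
noncomputable def hyp1F1 (a b x : ℂ) : ℂ :=
  ∑' k : ℕ, pochC a k * x ^ k / (pochC b k * (Nat.factorial k : ℂ))

lemma hasSum_congr' {f g : ℕ → ℂ} {a b : ℂ} (h : HasSum f a) (hf : ∀ k, g k = f k) (hab : b = a) :
    HasSum g b := by
  rw [hab, funext hf]; exact h

noncomputable def uC (a b : ℂ) (k : ℕ) : ℂ := pochC a k / (pochC b k * (Nat.factorial k : ℂ))

lemma pochC_succ (a : ℂ) (k : ℕ) : pochC a (k+1) = pochC a k * (a + k) := by
  simp only [pochC]
  exact ascPochhammer_succ_eval k a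

lemma pochC_zero (a : ℂ) : pochC a 0 = 1 := by simp [pochC]

lemma pochC_shift (a : ℂ) (k : ℕ) : a * pochC (a+1) k = pochC a k * (a + k) := by
  induction k with
  | zero => simp [pochC_zero]
  | succ n ih =>
    rw [pochC_succ, pochC_succ, ← mul_assoc, ih]
    push_cast; ring

lemma pochC_ne (b : ℂ) (hb : ∀ k : ℕ, b ≠ -(k : ℂ)) (k : ℕ) : pochC b k ≠ 0 := by
  induction k with
  | zero => simp [pochC_zero]
  | succ n ih =>
    rw [pochC_succ]
    exact mul_ne_zero ih (fun h => hb n (eq_neg_of_add_eq_zero_left h))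

lemma uC_succ (a b : ℂ) (k : ℕ) :
    uC a b (k+1) = uC a b k * ((a + k) / (b + k) * (1 / ((k:ℂ) + 1))) := by
  simp only [uC, pochC_succ, Nat.factorial_succ]
  push_cast
  rw [div_mul_div_comm, div_mul_div_comm]
  congr 1 <;> ring

lemma hyp_eq (a b x : ℂ) : hyp1F1 a b x = ∑' k : ℕ, uC a b k * x ^ k := by
  simp only [hyp1F1, uC]
  congr 1; ext k; ring

lemma uC_summable (a b x : ℂ) : Summable (fun k => uC a b k * x ^ k) := by
  have ht : Filter.Tendsto (fun k : ℕ => ‖(a + 1 * k) / (b + 1 * k) * (1 / ((k:ℂ) + 1)) * x‖)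
      Filter.atTop (nhds 0) := by
    have h1 := tendsto_add_mul_div_add_mul_atTop_nhds a b (1:ℂ) (one_ne_zero (α := ℂ))
    have h2 := tendsto_one_div_add_atTop_nhds_zero_nat (𝕜 := ℂ)
    simpa using ((h1.mul h2).mul_const x).norm
  refine summable_of_ratio_norm_eventually_le (r := 1/2) (by norm_num) ?_
  filter_upwards [ht.eventually (gt_mem_nhds (show (0:ℝ) < 1/2 by norm_num))] with k hk
  simp only [one_mul] at hk
  have : uC a b (k+1) * x^(k+1) =
      ((a + k) / (b + k) * (1 / ((k:ℂ) + 1)) * x) * (uC a b k * x^k) := by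
    rw [uC_succ]; ring
  rw [this, norm_mul]
  gcongr

lemma hyp_hasSum (a b x : ℂ) : HasSum (fun k => uC a b k * x ^ k) (hyp1F1 a b x) := by
  rw [hyp_eq]; exact (uC_summable a b x).hasSum

lemma bnd (a b : ℂ) (R : ℝ) (k : ℕ) (w : ℂ) (hw : w ∈ Metric.ball (0:ℂ) R) :
    ‖uC a b k * w ^ k‖ ≤ ‖uC a b k * (R:ℂ) ^ k‖ := by
  have hw' : ‖w‖ < R := by simpa using hw
  have : ‖(R:ℂ)‖ = R := by
    rw [Complex.norm_real]; exact abs_of_nonneg ((norm_nonneg w).trans hw'.le)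
  rw [norm_mul, norm_mul, norm_pow, norm_pow, this]
  gcongr

lemma hyp_diff (a b : ℂ) : Differentiable ℂ (hyp1F1 a b) := by
  intro x
  have e : hyp1F1 a b = fun x => ∑' k : ℕ, uC a b k * x ^ k := funext (hyp_eq a b)
  rw [e]
  refine (Complex.differentiableOn_tsum_of_summable_norm
    (uC_summable a b ((‖x‖+1 : ℝ):ℂ)).norm (fun i => by fun_prop) Metric.isOpen_ball
    (bnd a b _)).differentiableAt (Metric.isOpen_ball.mem_nhds ?_)
  simp

lemma hyp_deriv (a b x : ℂ) :
    HasSum (fun k : ℕ => (k:ℂ) * (uC a b k * x ^ k)) (x * deriv (hyp1F1 a b) x) := by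
  have e : hyp1F1 a b = fun x => ∑' k : ℕ, uC a b k * x ^ k := funext (hyp_eq a b)
  rw [e]
  have := Complex.hasSum_deriv_of_summable_norm
    (uC_summable a b ((‖x‖+1 : ℝ):ℂ)).norm (fun i => by fun_prop) Metric.isOpen_ball
    (bnd a b _) (z := x) (by simp)
  refine hasSum_congr' (this.mul_left x) (fun k => ?_) rfl
  simp only [deriv_const_mul_field, deriv_pow_field]
  cases k with
  | zero => simp
  | succ n => simp; ring

lemma rel1 (a b x : ℂ) :
    x * deriv (hyp1F1 a b) x = a * (hyp1F1 (a+1) b x - hyp1F1 a b x) := by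
  refine (hyp_deriv a b x).unique ?_
  refine hasSum_congr' (((hyp_hasSum (a+1) b x).sub (hyp_hasSum a b x)).mul_left a) (fun k => ?_) rfl
  have := pochC_shift a k
  simp only [uC, div_eq_mul_inv]
  linear_combination (-(pochC b k * (Nat.factorial k : ℂ))⁻¹ * x^k) * this

lemma rel2 (a b x : ℂ) (hb : ∀ k : ℕ, b ≠ -(k : ℂ)) :
    x * deriv (hyp1F1 (a+1) b) x
      = (b - a - 1) * hyp1F1 a b x + (a + 1 - b + x) * hyp1F1 (a+1) b x := by
  refine (hyp_deriv (a+1) b x).unique ?_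
  have hs : HasSum (fun k : ℕ => (k:ℂ) * (uC (a+1) b k * x ^ k)
      - ((b - a - 1) * (uC a b k * x ^ k) + (a + 1 - b) * (uC (a+1) b k * x ^ k)))
      (x * hyp1F1 (a+1) b x) := by
    rw [← hasSum_nat_add_iff' 1]
    refine hasSum_congr' ((hyp_hasSum (a+1) b x).mul_left x) (fun k => ?_) ?_
    · have e1 := pochC_succ (a+1) k
      have e2 := pochC_succ a k
      have e3 := pochC_shift a k
      have hb1 := pochC_ne b hb k
      have hb2 : b + k ≠ 0 := fun h => hb k (eq_neg_of_add_eq_zero_left h)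
      have hf : (Nat.factorial k : ℂ) ≠ 0 := by exact_mod_cast Nat.factorial_ne_zero k
      have hk : (k:ℂ) + 1 ≠ 0 := by exact_mod_cast Nat.succ_ne_zero k
      simp only [uC, e1, e2, ← e3, pochC_succ b, Nat.factorial_succ]
      push_cast
      field_simp
      ring
    · simp [uC, pochC_zero]; ring
  refine hasSum_congr' (hs.add (((hyp_hasSum a b x).mul_left (b-a-1)).add
    ((hyp_hasSum (a+1) b x).mul_left (a+1-b)))) (fun k => ?_) ?_
  · ring
  · ring

theorem stmt2 (α c : ℂ) (hca : c + α ≠ 0)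
    (h1 : ∀ k : ℕ, 1 + α ≠ -(k : ℂ))
    (h2 : ∀ k : ℕ, 1 - α ≠ -(k : ℂ)) :
    ∀ x : ℂ,
      (c / (c + α)) * hyp1F1 (1 - c) (1 + α) x * hyp1F1 (-c - α) (1 - α) x
        - hyp1F1 (-c) (1 + α) x * hyp1F1 (1 - c - α) (1 - α) x
        = -(α / (c + α)) * Complex.exp x := by
  have z : ∀ a b : ℂ, hyp1F1 a b 0 = 1 := by
    intro a b
    rw [hyp_eq, tsum_eq_single 0]
    · simp [uC, pochC_zero]
    · intro k hk; simp [hk]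
  have ea : (1 - c : ℂ) = -c + 1 := by ring
  have ed : (1 - c - α : ℂ) = (-c - α) + 1 := by ring
  rw [ed, ea]
  set A := hyp1F1 (-c+1) (1+α) with hA
  set B := hyp1F1 (-c) (1+α) with hB
  set C := hyp1F1 (-c-α) (1-α) with hC
  set D := hyp1F1 (-c-α+1) (1-α) with hD
  have dA : Differentiable ℂ A := hyp_diff _ _
  have dB : Differentiable ℂ B := hyp_diff _ _
  have dC : Differentiable ℂ C := hyp_diff _ _
  have dD : Differentiable ℂ D := hyp_diff _ _
  let W : ℂ → ℂ := fun x => (c * (A x * C x) - (c + α) * (B x * D x)) * Complex.exp (-x)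
  have dW : Differentiable ℂ W := by
    intro x; fun_prop
  have W0 : ∀ x, x ≠ 0 → deriv W x = 0 := by
    intro x hx
    have hd : HasDerivAt W _ x :=
      ((((dA x).hasDerivAt.mul (dC x).hasDerivAt).const_mul c).sub
        (((dB x).hasDerivAt.mul (dD x).hasDerivAt).const_mul (c+α))).mul
        ((hasDerivAt_id x).neg.cexp)
    rw [hd.deriv]
    have rA := rel2 (-c) (1+α) x h1
    have rB := rel1 (-c) (1+α) x
    have rC := rel1 (-c-α) (1-α) x
    have rD := rel2 (-c-α) (1-α) x h2
    rw [← hA, ← hB] at rA rB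
    rw [← hC, ← hD] at rC rD
    apply mul_left_cancel₀ hx
    simp only [Pi.mul_apply, Pi.sub_apply, Pi.neg_apply, id]
    linear_combination Complex.exp (-x) * (c * C x * rA + c * A x * rC
      - (c+α) * D x * rB - (c+α) * B x * rD)
  have cW : Continuous (deriv W) := (dW.contDiff (n := 1)).continuous_deriv le_rfl
  have W1 : deriv W = fun _ => 0 :=
    Continuous.ext_on (dense_compl_singleton (0:ℂ)) cW continuous_const (fun x hx => W0 x hx)
  intro x
  have hc := is_const_of_deriv_eq_zero dW (fun x => congrFun W1 x) x 0
  have hE : Complex.exp (-x) * Complex.exp x = 1 := by rw [← Complex.exp_add]; simp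
  simp only [W, hA, hB, hC, hD, z] at hc
  rw [← hA, ← hB, ← hC, ← hD] at hc
  simp at hc
  field_simp
  linear_combination Complex.exp x * hc - (c * (A x * C x) - (c + α) * (B x * D x)) * hE
end

section
/- Let α, c be real numbers with c+α > 0, c ≠ 0, and c, c+α not nonpositive integers. Consider the CAL polynomials with μ = c+α. Then for every n ≥ 0 and every x, L_n^α(x; c, c+α) = ((c+α+1)_n / n!) · ∑_{k=0}^n [ (−n)_k / ((c+1)_k (c+α+1)_k) ] · ( ∑_{j=0}^{n−k} [ (k−n)_j (c+1)_j (c+α)_j ] / [ (c+k+1)_j (c+α+k+1)_j j! ] ) · x^k. -/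
/-- Pochhammer symbol `(a)_k` for real `a`. -/
noncomputable def pochR (a : ℝ) (k : ℕ) : ℝ := (ascPochhammer ℝ k).eval a

lemma pochR_zero (a : ℝ) : pochR a 0 = 1 := by simp [pochR]

lemma pochR_succ (a : ℝ) (k : ℕ) : pochR a (k + 1) = pochR a k * (a + k) := by
  simp [pochR, ascPochhammer_succ_eval]

lemma pochR_succ_left (a : ℝ) (k : ℕ) : pochR a (k + 1) = a * pochR (a + 1) k := by
  induction k with
  | zero => simp [pochR_succ, pochR_zero]
  | succ k ih => rw [pochR_succ, ih, pochR_succ]; push_cast; ring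

lemma pochR_add (a : ℝ) (k j : ℕ) : pochR a (k + j) = pochR a k * pochR (a + k) j := by
  induction j with
  | zero => simp [pochR_zero]
  | succ j ih => rw [← add_assoc, pochR_succ, ih, pochR_succ]; push_cast; ring

lemma pochR_ne (a : ℝ) (h : ∀ k : ℕ, a + k ≠ 0) (k : ℕ) : pochR a k ≠ 0 := by
  induction k with
  | zero => simp [pochR_zero]
  | succ k ih => rw [pochR_succ]; exact mul_ne_zero ih (h k)

lemma pochR_neg_zero (n m : ℕ) (h : n < m) : pochR (-(n : ℝ)) m = 0 := by
  obtain ⟨j, rfl⟩ := Nat.exists_eq_add_of_lt h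
  rw [show n + j + 1 = (n + 1) + j by ring, pochR_add, pochR_succ]
  simp

/-- partial sums -/
lemma part_sum (a : ℝ) (M : ℕ) :
    ∑ m ∈ Finset.range (M + 1), pochR a m / (m.factorial : ℝ)
      = pochR (a + 1) M / (M.factorial : ℝ) := by
  induction M with
  | zero => simp [pochR_zero]
  | succ M ih =>
    rw [Finset.sum_range_succ, ih, pochR_succ_left, pochR_succ, Nat.factorial_succ]
    have : (M.factorial : ℝ) ≠ 0 := by positivity
    push_cast
    field_simp
    ring

lemma full_sum (n : ℕ) :
    ∑ m ∈ Finset.range (n + 2), pochR (-((n + 1 : ℕ) : ℝ)) m / (m.factorial : ℝ) = 0 := by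
  rw [part_sum, show -((n + 1 : ℕ) : ℝ) + 1 = -(n : ℝ) by push_cast; ring,
    pochR_neg_zero _ _ (Nat.lt_succ_self n)]
  simp

lemma v_shift (n m : ℕ) :
    pochR (-((n + 1 : ℕ) : ℝ)) (m + 1) = -((n : ℝ) + 1) * pochR (-(n : ℝ)) m := by
  rw [pochR_succ_left, show -((n + 1 : ℕ) : ℝ) + 1 = -(n : ℝ) by push_cast; ring]
  push_cast; ring

lemma v_up (n m : ℕ) :
    ((n : ℝ) + 1) * pochR (-(n : ℝ)) m
      = ((n : ℝ) + 1 - m) * pochR (-((n + 1 : ℕ) : ℝ)) m := by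
  have h := v_shift n m
  rw [pochR_succ] at h
  push_cast at h ⊢
  linear_combination h

lemma shift_sum (n : ℕ) :
    ∑ m ∈ Finset.range (n + 1), pochR (-(n : ℝ)) m / ((m + 1).factorial : ℝ)
      = 1 / ((n : ℝ) + 1) := by
  have h := full_sum n
  rw [Finset.sum_range_succ'] at h
  simp only [v_shift, mul_div_assoc, pochR_zero, Nat.factorial_zero] at h
  rw [← Finset.mul_sum] at h
  have : (n : ℝ) + 1 ≠ 0 := by positivity
  rw [eq_div_iff this]
  push_cast at h
  linarith

lemma c_sum (n : ℕ) (c : ℝ) :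
    ∑ m ∈ Finset.range (n + 2), pochR (-((n + 1 : ℕ) : ℝ)) m * ((c + m + 1) / ((m + 1).factorial : ℝ))
      = c / ((n : ℝ) + 2) := by
  have h1 := shift_sum (n + 1)
  have h2 := full_sum n
  have : ∀ m ∈ Finset.range (n + 2),
      pochR (-((n + 1 : ℕ) : ℝ)) m * ((c + m + 1) / ((m + 1).factorial : ℝ))
      = c * (pochR (-((n + 1 : ℕ) : ℝ)) m / ((m + 1).factorial : ℝ))
        + pochR (-((n + 1 : ℕ) : ℝ)) m / (m.factorial : ℝ) := by
    intro m _
    rw [Nat.factorial_succ]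
    have : (m.factorial : ℝ) ≠ 0 := by positivity
    have : (m : ℝ) + 1 ≠ 0 := by positivity
    push_cast
    field_simp
    ring
  rw [Finset.sum_congr rfl this, Finset.sum_add_distrib, ← Finset.mul_sum, h1, h2]
  push_cast
  ring

noncomputable def calQ (c d x : ℝ) (m : ℕ) : ℝ :=
  ∑ k ∈ Finset.range (m + 1), x ^ k *
    (pochR (c + 1) (m - k) * pochR d (m - k) / ((m - k).factorial : ℝ))

noncomputable def calR (c d x : ℝ) (m : ℕ) : ℝ :=
  calQ c d x m / (pochR (c + 1) m * pochR (d + 1) m)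

noncomputable def calP (c d x : ℝ) (n : ℕ) : ℝ :=
  ∑ m ∈ Finset.range (n + 1), pochR (-(n : ℝ)) m * calR c d x m

lemma calQ_succ (c d x : ℝ) (m : ℕ) :
    calQ c d x (m + 1) = x * calQ c d x m
      + pochR (c + 1) (m + 1) * pochR d (m + 1) / ((m + 1).factorial : ℝ) := by
  unfold calQ
  rw [Finset.sum_range_succ', Finset.mul_sum]
  simp only [Nat.add_sub_add_right, pow_succ, pow_zero, Nat.sub_zero, one_mul]
  congr 1
  apply Finset.sum_congr rfl
  intros
  ring

lemma calR_succ (c d x : ℝ) (hc : ∀ k : ℕ, c + 1 + k ≠ 0) (hd : ∀ k : ℕ, d + 1 + k ≠ 0) (m : ℕ) :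
    x * calR c d x m = (c + (m + 1 : ℕ)) * (d + (m + 1 : ℕ)) * calR c d x (m + 1)
      - d * ((c + m + 1) / ((m + 1).factorial : ℝ)) := by
  unfold calR
  rw [calQ_succ]
  have h1 := pochR_ne _ hc m
  have h2 := pochR_ne _ hd m
  have h3 := hc m
  have h4 := hd m
  have h5 : ((m + 1).factorial : ℝ) ≠ 0 := by positivity
  rw [pochR_succ_left d, pochR_succ (c + 1), pochR_succ (d + 1)]
  push_cast
  field_simp
  ring

lemma calP_ext (c d x : ℝ) (n N : ℕ) (h : n ≤ N) :
    calP c d x n = ∑ m ∈ Finset.range (N + 1), pochR (-(n : ℝ)) m * calR c d x m := by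
  unfold calP
  apply Finset.sum_subset
  · intro a; simp only [Finset.mem_range]; omega
  · intro a _ ha
    simp only [Finset.mem_range] at ha
    rw [pochR_neg_zero n a (by omega), zero_mul]

lemma x_calP (c d x : ℝ) (hc : ∀ k : ℕ, c + 1 + k ≠ 0) (hd : ∀ k : ℕ, d + 1 + k ≠ 0) (n : ℕ) :
    ((n : ℝ) + 2) * (x * calP c d x (n + 1)) =
      - ∑ m ∈ Finset.range (n + 3), pochR (-((n + 2 : ℕ) : ℝ)) m *
          ((c + m) * (d + m) * calR c d x m) := by
  have h := c_sum n c
  have h0 : (n : ℝ) + 2 ≠ 0 := by positivity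
  rw [eq_div_iff h0] at h
  rw [Finset.sum_range_succ']
  have e : x * calP c d x (n + 1) =
      ∑ m ∈ Finset.range (n + 2), pochR (-((n + 1 : ℕ) : ℝ)) m *
        ((c + (m + 1 : ℕ)) * (d + (m + 1 : ℕ)) * calR c d x (m + 1))
      - d * ∑ m ∈ Finset.range (n + 2),
        pochR (-((n + 1 : ℕ) : ℝ)) m * ((c + m + 1) / ((m + 1).factorial : ℝ)) := by
    unfold calP
    rw [Finset.mul_sum, Finset.mul_sum, ← Finset.sum_sub_distrib]
    apply Finset.sum_congr rfl
    intro m _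
    have := calR_succ c d x hc hd m
    linear_combination pochR (-((n + 1 : ℕ) : ℝ)) m * this
  have e2 : ∑ m ∈ Finset.range (n + 2), pochR (-((n + 2 : ℕ) : ℝ)) (m + 1) *
        ((c + (m + 1 : ℕ)) * (d + (m + 1 : ℕ)) * calR c d x (m + 1))
      = -((n : ℝ) + 2) * ∑ m ∈ Finset.range (n + 2), pochR (-((n + 1 : ℕ) : ℝ)) m *
        ((c + (m + 1 : ℕ)) * (d + (m + 1 : ℕ)) * calR c d x (m + 1)) := by
    rw [Finset.mul_sum]
    apply Finset.sum_congr rfl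
    intro m _
    rw [v_shift (n + 1) m]
    push_cast
    ring
  have r0 : calR c d x 0 = 1 := by simp [calR, calQ, pochR_zero]
  rw [e2, e, r0, pochR_zero]
  push_cast at h ⊢
  linear_combination (-d) * h

lemma calP_rec (c d x : ℝ) (hc : ∀ k : ℕ, c + 1 + k ≠ 0) (hd : ∀ k : ℕ, d + 1 + k ≠ 0) (n : ℕ) :
    ((n : ℝ) + 2) * ((2 * ((n : ℝ) + 1) + c + d + 1 - x) * calP c d x (n + 1)) =
      ((n : ℝ) + 1 + c + 1) * (d + ((n : ℝ) + 1) + 1) * calP c d x (n + 2)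
        + ((n : ℝ) + 2) * (((n : ℝ) + 1) * calP c d x n) := by
  have h := x_calP c d x hc hd n
  have key : ((n : ℝ) + 2) * ((2 * ((n : ℝ) + 1) + c + d + 1) * calP c d x (n + 1))
      + ∑ m ∈ Finset.range (n + 3), pochR (-((n + 2 : ℕ) : ℝ)) m *
          ((c + m) * (d + m) * calR c d x m) =
      ((n : ℝ) + 1 + c + 1) * (d + ((n : ℝ) + 1) + 1) * calP c d x (n + 2)
        + ((n : ℝ) + 2) * (((n : ℝ) + 1) * calP c d x n) := by
    rw [calP_ext c d x (n + 1) (n + 2) (by omega), calP_ext c d x (n + 2) (n + 2) le_rfl,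
      calP_ext c d x n (n + 2) (by omega)]
    simp only [Finset.mul_sum]
    rw [← Finset.sum_add_distrib, ← Finset.sum_add_distrib]
    apply Finset.sum_congr rfl
    intro m _
    have a1 := v_up n m
    have a2 := v_up (n + 1) m
    rw [show n + 1 + 1 = n + 2 by ring] at a2
    generalize pochR (-((n + 2 : ℕ) : ℝ)) m = v2 at *
    generalize pochR (-((n + 1 : ℕ) : ℝ)) m = v1 at *
    generalize pochR (-(n : ℝ)) m = v0 at *
    generalize calR c d x m = r at *
    push_cast at a2
    linear_combination (-r * ((n : ℝ) + 2)) * a1 + r * (c + d + n + m + 2) * a2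
  linear_combination key - h

lemma calP_closed (α c x : ℝ) (n : ℕ) :
        ∑ k ∈ Finset.range (n + 1),
          pochR (-(n : ℝ)) k / (pochR (c + 1) k * pochR (c + α + 1) k) *
            (∑ j ∈ Finset.range (n - k + 1),
              pochR ((k : ℝ) - (n : ℝ)) j * pochR (c + 1) j * pochR (c + α) j /
                (pochR (c + (k : ℝ) + 1) j * pochR (c + α + (k : ℝ) + 1) j *
                  (Nat.factorial j : ℝ))) *
            x ^ k = calP c (c + α) x n := by
  unfold calP calR calQ
  have h := Finset.sum_range_diag_flip (n + 1) (fun k j : ℕ =>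
    pochR (-(n : ℝ)) (k + j) / (pochR (c + 1) (k + j) * pochR (c + α + 1) (k + j)) *
      (x ^ k * (pochR (c + 1) j * pochR (c + α) j / (j.factorial : ℝ))))
  refine Eq.trans ?_ (h.symm.trans ?_)
  · apply Finset.sum_congr rfl
    intro k hk
    rw [Finset.mem_range] at hk
    rw [show n + 1 - k = n - k + 1 by omega, Finset.mul_sum, Finset.sum_mul]
    apply Finset.sum_congr rfl
    intro j _
    rw [pochR_add, pochR_add, pochR_add, show -(n : ℝ) + k = k - n by ring,
      show c + 1 + (k : ℝ) = c + k + 1 by ring, show c + α + 1 + (k : ℝ) = c + α + k + 1 by ring]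
    simp only [div_eq_mul_inv, mul_inv]
    ring
  · apply Finset.sum_congr rfl
    intro m _
    rw [Finset.sum_div, Finset.mul_sum]
    apply Finset.sum_congr rfl
    intro k hk
    rw [Finset.mem_range] at hk
    rw [show k + (m - k) = m by omega]
    ring

theorem stmt13 (α c : ℝ) (hca : 0 < c + α) (hc0 : c ≠ 0)
    (hcz : ∀ k : ℕ, c ≠ -(k : ℝ))
    (hcαz : ∀ k : ℕ, c + α ≠ -(k : ℝ))
    (L : ℤ → ℝ → ℝ)
    (hinitm : ∀ x : ℝ, L (-1) x = (c + α) / (c + α))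
    (hinit0 : ∀ x : ℝ, L 0 x = 1)
    (hrec : ∀ n : ℕ, ∀ x : ℝ,
      (2 * (n : ℝ) + 2 * c + α + 1 - x) * L (n : ℤ) x
        = ((n : ℝ) + c + 1) * L ((n : ℤ) + 1) x + ((n : ℝ) + c + α) * L ((n : ℤ) - 1) x) :
    ∀ n : ℕ, ∀ x : ℝ,
      L (n : ℤ) x = pochR (c + α + 1) n / (Nat.factorial n : ℝ) *
        ∑ k ∈ Finset.range (n + 1),
          pochR (-(n : ℝ)) k / (pochR (c + 1) k * pochR (c + α + 1) k) *
            (∑ j ∈ Finset.range (n - k + 1),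
              pochR ((k : ℝ) - (n : ℝ)) j * pochR (c + 1) j * pochR (c + α) j /
                (pochR (c + (k : ℝ) + 1) j * pochR (c + α + (k : ℝ) + 1) j *
                  (Nat.factorial j : ℝ))) *
            x ^ k := by
  have hc : ∀ k : ℕ, c + 1 + k ≠ 0 := by
    intro k hk
    apply hcz (k + 1)
    push_cast
    linarith
  have hd : ∀ k : ℕ, c + α + 1 + k ≠ 0 := by
    intro k
    positivity
  intro n x
  rw [calP_closed]
  have main : ∀ n : ℕ,
      L (n : ℤ) x = pochR (c + α + 1) n / (Nat.factorial n : ℝ) * calP c (c + α) x n ∧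
      L ((n + 1 : ℕ) : ℤ) x =
        pochR (c + α + 1) (n + 1) / (Nat.factorial (n + 1) : ℝ) * calP c (c + α) x (n + 1) := by
    intro n
    induction n with
    | zero =>
      constructor
      · simp [hinit0, calP, calR, calQ, pochR_zero]
      · have h := hrec 0 x
        have e1 : c + 1 ≠ 0 := by simpa using hc 0
        have e2 : c + α + 1 ≠ 0 := by simpa using hd 0
        simp only [Nat.cast_zero, zero_add, zero_sub, hinit0, hinitm, div_self hca.ne'] at h
        have : L 1 x = 1 - x / (c + 1) := by
          field_simp
          linarith
        simp [this, calP, calR, calQ, pochR_zero, pochR_succ, Finset.sum_range_succ]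
        field_simp
        ring
    | succ n ih =>
      refine ⟨ih.2, ?_⟩
      obtain ⟨h1, h2⟩ := ih
      have h := hrec (n + 1) x
      rw [show ((n + 1 : ℕ) : ℤ) - 1 = (n : ℤ) by push_cast; ring,
        show ((n + 1 : ℕ) : ℤ) + 1 = ((n + 1 + 1 : ℕ) : ℤ) by push_cast; ring, h1, h2] at h
      have hr := calP_rec c (c + α) x hc hd n
      have e1 := hc (n + 1)
      push_cast at e1
      have e1' : (n : ℝ) + 1 + c + 1 ≠ 0 := by
        intro h; apply e1; linarith
      apply mul_left_cancel₀ e1'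
      have f : (n.factorial : ℝ) ≠ 0 := by positivity
      have f1 : (n : ℝ) + 1 ≠ 0 := by positivity
      have f2 : (n : ℝ) + 1 + 1 ≠ 0 := by positivity
      rw [show n + 1 + 1 = n + 2 by ring] at h ⊢
      rw [show Nat.factorial (n + 2) = (n + 2) * ((n + 1) * n.factorial) from rfl,
        pochR_succ _ (n + 1), pochR_succ]
      rw [Nat.factorial_succ, pochR_succ] at h
      push_cast at h ⊢
      generalize pochR (c + α + 1) n = q at *
      generalize calP c (c + α) x n = P0 at *
      generalize calP c (c + α) x (n + 1) = P1 at *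
      generalize calP c (c + α) x (n + 2) = P2 at *
      have h' := eq_sub_of_add_eq h.symm
      rw [h']
      have f3 : (n : ℝ) + 2 ≠ 0 := by positivity
      field_simp
      linear_combination (q * (c + α + 1 + n)) * hr
  exact (main n).1
end
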